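/- Let (V_i)_{i ∈ ℕ} be an inverse system of finite-dimensional k-vector spaces with uniformly bounded dimensions. For each i define the stable subspace V_i^s = ⋂_{j > i} Im(f_{ji} : V_j → V_i). Then the transition maps restrict to surjections V_{j}^s → V_i^s for j ≥ i, and there exists N such that for all i ≥ N the map V_{i+1}^s → V_i^s is an isomorphism. -/

import Mathlib

/-- The stable subspace `V_i^s = ⋂_{j > i} Im (f_{ji} : V_j → V_i)` of an inverse
system of vector spaces. -/
def stableSubspace {k : Type*} [Field k] (V : ℕ → Type*) [∀ i, AddCommGroup (V i)]
    [∀ i, Module k (V i)] (f : ∀ i j, i ≤ j → (V j →ₗ[k] V i)) (i : ℕ) :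
    Submodule k (V i) :=
  ⨅ (j : ℕ) (h : i < j), LinearMap.range (f i j h.le)

theorem stab_aux {k : Type*} [Field k] (V : ℕ → Type*) [∀ i, AddCommGroup (V i)]
    [∀ i, Module k (V i)] [∀ i, FiniteDimensional k (V i)]
    (f : ∀ i j, i ≤ j → (V j →ₗ[k] V i))
    (hcomp : ∀ i j l (hij : i ≤ j) (hjl : j ≤ l),
      (f i j hij).comp (f j l hjl) = f i l (hij.trans hjl)) (i : ℕ) :
    ∃ n, ∀ m (h : i ≤ m), n ≤ m → LinearMap.range (f i m h) = stableSubspace V f i := by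
  have anti : ∀ a b (ha : i ≤ a) (hab : a ≤ b),
      LinearMap.range (f i b (ha.trans hab)) ≤ LinearMap.range (f i a ha) := by
    intro a b ha hab
    rw [← hcomp i a b ha hab]
    exact LinearMap.range_comp_le_range _ _
  let g : ℕ →o (Submodule k (V i))ᵒᵈ :=
    { toFun := fun n => OrderDual.toDual (LinearMap.range (f i (i + n) (Nat.le_add_right i n)))
      monotone' := fun a b hab => anti (i + a) (i + b) (Nat.le_add_right i a) (by omega) }
  obtain ⟨n, hn⟩ := (monotone_stabilizes_iff_artinian (R := k) (M := V i)).mpr inferInstance g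
  have hn' : ∀ m (h : i ≤ m), i + n ≤ m →
      LinearMap.range (f i m h) = LinearMap.range (f i (i + n) (Nat.le_add_right i n)) := by
    intro m h hm
    obtain ⟨c, rfl⟩ := Nat.exists_eq_add_of_le h
    exact (hn c (by omega)).symm
  refine ⟨i + n + 1, fun m h hm => le_antisymm ?_ ?_⟩
  · refine le_iInf fun j => le_iInf fun hj => ?_
    rw [hn' m h (by omega), ← hn' (max j m) (by omega) (by omega)]
    exact anti j (max j m) hj.le (le_max_left _ _)
  · exact iInf_le_of_le m (iInf_le_of_le (by omega) le_rfl)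

theorem stmt1 {k : Type*} [Field k] (V : ℕ → Type*) [∀ i, AddCommGroup (V i)]
    [∀ i, Module k (V i)] [∀ i, FiniteDimensional k (V i)]
    (f : ∀ i j, i ≤ j → (V j →ₗ[k] V i))
    (hid : ∀ i, f i i le_rfl = LinearMap.id)
    (hcomp : ∀ i j l (hij : i ≤ j) (hjl : j ≤ l),
      (f i j hij).comp (f j l hjl) = f i l (hij.trans hjl))
    (N₀ : ℕ) (hN₀ : ∀ i, Module.finrank k (V i) ≤ N₀) :
    (∀ i j (h : i ≤ j),
      Submodule.map (f i j h) (stableSubspace V f j) = stableSubspace V f i) ∧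
    ∃ N : ℕ, ∀ i, N ≤ i →
      Submodule.map (f i (i + 1) (Nat.le_succ i)) (stableSubspace V f (i + 1))
          = stableSubspace V f i ∧
      LinearMap.ker (f i (i + 1) (Nat.le_succ i)) ⊓ stableSubspace V f (i + 1) = ⊥ := by
  have h1 : ∀ i j (h : i ≤ j),
      Submodule.map (f i j h) (stableSubspace V f j) = stableSubspace V f i := by
    intro i j h
    obtain ⟨a, ha⟩ := stab_aux V f hcomp i
    obtain ⟨b, hb⟩ := stab_aux V f hcomp j
    have hl : j ≤ max j (max a b) := le_max_left _ _
    rw [← hb (max j (max a b)) hl (by omega), ← ha (max j (max a b)) (h.trans hl) (by omega),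
      ← LinearMap.range_comp, hcomp]
  refine ⟨h1, ?_⟩
  let d : ℕ → ℕ := fun i => Module.finrank k (stableSubspace V f i)
  have hbd : BddAbove (Set.range d) := by
    refine ⟨N₀, ?_⟩
    rintro _ ⟨i, rfl⟩
    exact (Submodule.finrank_le _).trans (hN₀ i)
  obtain ⟨N, hN⟩ := Nat.sSup_mem (Set.range_nonempty d) hbd
  have hmax : ∀ i, d i ≤ d N := fun i => hN ▸ le_csSup hbd ⟨i, rfl⟩
  refine ⟨N, fun i hi => ⟨h1 _ _ _, ?_⟩⟩
  have hmono : d N ≤ d i := by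
    change Module.finrank k (stableSubspace V f N) ≤ _
    rw [← h1 N i hi]
    exact Submodule.finrank_map_le _ _
  have hr := LinearMap.finrank_range_add_finrank_ker
    ((f i (i + 1) (Nat.le_succ i)).domRestrict (stableSubspace V f (i + 1)))
  rw [LinearMap.range_domRestrict, h1] at hr
  have h3 : d (i + 1) ≤ d i := (hmax _).trans hmono
  have h0 : Module.finrank k (LinearMap.ker
      ((f i (i + 1) (Nat.le_succ i)).domRestrict (stableSubspace V f (i + 1)))) = 0 := by
    simp only [d] at h3
    omega
  rw [Submodule.finrank_eq_zero] at h0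
  rw [eq_bot_iff]
  rintro x ⟨hx, hxs⟩
  have : (⟨x, hxs⟩ : stableSubspace V f (i + 1)) ∈ LinearMap.ker
      ((f i (i + 1) (Nat.le_succ i)).domRestrict (stableSubspace V f (i + 1))) := by
    simpa using hx
  rw [h0] at this
  simpa using this
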